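/- arXiv:1902.07165 — 10 statements merged into one kernel-verified Lean document; each statement's English description precedes it below -/
import Mathlib

section
/- Let 𝒯 be a finite tile set (each tile with nonempty area) with target frequencies (α_T)_{T∈𝒯} such that the constraint set P(𝒯,α) is nonempty, and let p* be a maximum entropy distribution for (𝒯,α). Then p* factorizes as a product of its entry marginals: for every D ∈ 𝒟, p*(D) = ∏_{(i,j)∈{1,…,n}×{1,…,m}} p*((i,j) = D(i,j)). -/
open Finset

namespace TileCompare

variable {n m : ℕ}

/-- A binary dataset: an `n × m` matrix with entries in `{0,1}`, encoded as booleans. -/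
abbrev Dataset (n m : ℕ) := Fin n → Fin m → Bool

/-- A tile: a set of rows together with a set of columns. -/
abbrev Tile (n m : ℕ) := Finset (Fin n) × Finset (Fin m)

/-- The area of a tile: the Cartesian product of its rows and columns. -/
def area (T : Tile n m) : Finset (Fin n × Fin m) := T.1 ×ˢ T.2

/-- The frequency of a tile in a dataset: the proportion of ones inside its area. -/
noncomputable def freqD (T : Tile n m) (D : Dataset n m) : ℝ :=
  (∑ e ∈ area T, if D e.1 e.2 then (1 : ℝ) else 0) / ((area T).card : ℝ)

/-- The frequency of a tile under a distribution over datasets. -/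
noncomputable def freqP (T : Tile n m) (p : Dataset n m → ℝ) : ℝ :=
  ∑ D : Dataset n m, p D * freqD T D

/-- `p` is a probability distribution over the (finite) space of all `n × m` binary datasets. -/
def IsDistribution (p : Dataset n m → ℝ) : Prop :=
  (∀ D, 0 ≤ p D) ∧ ∑ D : Dataset n m, p D = 1

/-- The entry marginal `p((i,j) = v)`. -/
noncomputable def marginal (p : Dataset n m → ℝ) (e : Fin n × Fin m) (v : Bool) : ℝ :=
  ∑ D : Dataset n m, if D e.1 e.2 = v then p D else 0

/-- Shannon entropy (natural logarithm; `0 · log 0 = 0` since `Real.log 0 = 0`). -/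
noncomputable def entropy (p : Dataset n m → ℝ) : ℝ :=
  -∑ D : Dataset n m, p D * Real.log (p D)

/-- Kullback–Leibler divergence (natural logarithm, conventions `0·log 0 = 0`, `0·log(0/0) = 0`). -/
noncomputable def KL (p q : Dataset n m → ℝ) : ℝ :=
  ∑ D : Dataset n m, p D * Real.log (p D / q D)

/-- `p` is a distribution matching the target frequencies `α` on the tile set `Ts`,
i.e. `p ∈ P(Ts, α)`. -/
def Consistent (Ts : Finset (Tile n m)) (α : Tile n m → ℝ) (p : Dataset n m → ℝ) : Prop :=
  IsDistribution p ∧ ∀ T ∈ Ts, freqP T p = α T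

/-- `p` is a maximum entropy distribution for `(Ts, α)`. -/
def IsMaxEnt (Ts : Finset (Tile n m)) (α : Tile n m → ℝ) (p : Dataset n m → ℝ) : Prop :=
  Consistent Ts α p ∧ ∀ q, Consistent Ts α q → entropy q ≤ entropy p

/-- The area covered by a set of tiles. -/
def areaSet (Ts : Finset (Tile n m)) : Finset (Fin n × Fin m) := Ts.biUnion area

/-- Entry marginal of the product distribution associated with a set of tiles exact w.r.t.
`Din`: equal to the indicator of the data entry on covered entries, `1/2` elsewhere. -/
noncomputable def mu (Din : Dataset n m) (Ts : Finset (Tile n m))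
    (e : Fin n × Fin m) (v : Bool) : ℝ :=
  if e ∈ areaSet Ts then (if Din e.1 e.2 = v then 1 else 0) else 1 / 2

/-- The product distribution associated with a set of exact tiles. -/
noncomputable def prodDist (Din : Dataset n m) (Ts : Finset (Tile n m))
    (D : Dataset n m) : ℝ :=
  ∏ e : Fin n × Fin m, mu Din Ts e (D e.1 e.2)

/-- The distance `d(Ts, Us; Bs)` computed from the product distributions of exact tile sets. -/
noncomputable def distE (Din : Dataset n m) (Ts Us Bs : Finset (Tile n m)) : ℝ :=
  if KL (prodDist Din (Ts ∪ Us ∪ Bs)) (prodDist Din Bs) = 0 then 1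
  else (KL (prodDist Din (Ts ∪ Us ∪ Bs)) (prodDist Din (Us ∪ Bs))
      + KL (prodDist Din (Ts ∪ Us ∪ Bs)) (prodDist Din (Ts ∪ Bs)))
      / KL (prodDist Din (Ts ∪ Us ∪ Bs)) (prodDist Din Bs)

/-- The distance `d(Ts, Us; Bs)` computed from given (maximum entropy) distributions
`pM, pTB, pUB, pB` for `Ts ∪ Us ∪ Bs`, `Ts ∪ Bs`, `Us ∪ Bs`, `Bs` respectively. -/
noncomputable def distKL (pM pTB pUB pB : Dataset n m → ℝ) : ℝ :=
  if KL pM pB = 0 then 1 else (KL pM pUB + KL pM pTB) / KL pM pB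

/-- Expectation of a function of one entry, in terms of the marginal. -/
lemma sum_mul_entry (p : Dataset n m → ℝ) (e : Fin n × Fin m) (f : Bool → ℝ) :
    ∑ D : Dataset n m, p D * f (D e.1 e.2) = ∑ v, marginal p e v * f v := by
  unfold marginal
  simp_rw [Finset.sum_mul]
  rw [Finset.sum_comm]
  refine Finset.sum_congr rfl fun D _ => ?_
  simp [ite_mul]

/-- Sum over datasets of a product over entries. -/
lemma sum_prod_entry (g : Fin n × Fin m → Bool → ℝ) :
    ∑ D : Dataset n m, ∏ e : Fin n × Fin m, g e (D e.1 e.2) = ∏ e, ∑ v, g e v := by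
  rw [Finset.prod_univ_sum, Fintype.piFinset_univ]
  exact Fintype.sum_equiv (Equiv.curry (Fin n) (Fin m) Bool).symm _ _ (fun D => rfl)

lemma marginal_prod (g : Fin n × Fin m → Bool → ℝ) (hg : ∀ e, ∑ v, g e v = 1)
    (e : Fin n × Fin m) (v : Bool) :
    marginal (fun D => ∏ e : Fin n × Fin m, g e (D e.1 e.2)) e v = g e v := by
  have h1 : ∀ D : Dataset n m,
      (if D e.1 e.2 = v then ∏ e : Fin n × Fin m, g e (D e.1 e.2) else 0)
      = ∏ e' : Fin n × Fin m,
        (fun a b => g a b * (if a = e then (if b = v then 1 else 0) else 1)) e' (D e'.1 e'.2) := by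
    intro D
    simp only [Finset.prod_mul_distrib]
    rw [Finset.prod_ite_eq' Finset.univ e (fun a => if D a.1 a.2 = v then (1 : ℝ) else 0)]
    simp
  unfold marginal
  rw [Finset.sum_congr rfl fun D _ => h1 D, sum_prod_entry
    (fun a b => g a b * (if a = e then (if b = v then 1 else 0) else 1)), Finset.prod_eq_single e]
  · simp
  · intro b _ hb
    simp only [if_neg hb, mul_one, hg]
  · simp

lemma freqP_eq (T : Tile n m) (p : Dataset n m → ℝ) :
    freqP T p = (∑ e ∈ area T, marginal p e true) / ((area T).card : ℝ) := by
  unfold freqP freqD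
  simp_rw [← mul_div_assoc]
  rw [← Finset.sum_div]
  congr 1
  simp_rw [Finset.mul_sum]
  rw [Finset.sum_comm]
  refine Finset.sum_congr rfl fun e _ => ?_
  rw [sum_mul_entry p e (fun b => if b then 1 else 0)]
  simp

lemma sum_marginal (p : Dataset n m → ℝ) (e : Fin n × Fin m) :
    ∑ v, marginal p e v = ∑ D, p D := by
  have := sum_mul_entry p e (fun _ => 1)
  simpa using this.symm

lemma gibbs_term (a b : ℝ) (ha : 0 ≤ a) (hb : 0 ≤ b) (hab : b = 0 → a = 0) :
    0 ≤ a * Real.log a - a * Real.log b - a + b ∧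
      (a * Real.log a - a * Real.log b - a + b = 0 → a = b) := by
  rcases ha.eq_or_lt with rfl | ha
  · refine ⟨by simpa using hb, fun h => by simpa using h.symm⟩
  · have hb' : 0 < b := lt_of_le_of_ne hb fun h => ha.ne' (hab h.symm)
    by_cases h : a = b
    · subst h; simp
    · have h1 := Real.log_lt_sub_one_of_pos (div_pos hb' ha)
        (fun h2 => h ((div_eq_one_iff_eq ha.ne').1 h2).symm)
      rw [Real.log_div hb'.ne' ha.ne'] at h1
      have h2 := mul_lt_mul_of_pos_left h1 ha
      have h3 : a * (b / a - 1) = b - a := by field_simp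
      rw [h3] at h2
      refine ⟨by nlinarith, fun h4 => by nlinarith⟩

/-- A maximum entropy distribution for a feasible tile-set constraint
factorizes as a product of its entry marginals. -/
theorem maxEnt_factorizes {n m : ℕ} (Ts : Finset (Tile n m)) (α : Tile n m → ℝ)
    (hne : ∀ T ∈ Ts, (area T).Nonempty)
    (hfeas : ∃ p, Consistent Ts α p)
    (p : Dataset n m → ℝ) (hp : IsMaxEnt Ts α p) :
    ∀ D : Dataset n m, p D = ∏ e : Fin n × Fin m, marginal p e (D e.1 e.2) := by
  obtain ⟨⟨⟨hp0, hp1⟩, hpT⟩, hmax⟩ := hp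
  set q : Dataset n m → ℝ := fun D => ∏ e : Fin n × Fin m, marginal p e (D e.1 e.2) with hq
  have hm0 : ∀ e v, 0 ≤ marginal p e v := fun e v =>
    Finset.sum_nonneg fun D _ => by split_ifs <;> simp [hp0]
  have hm1 : ∀ e, ∑ v, marginal p e v = 1 := fun e => by rw [sum_marginal, hp1]
  have hqm : ∀ e v, marginal q e v = marginal p e v := marginal_prod _ hm1
  have hq0 : ∀ D, 0 ≤ q D := fun D => Finset.prod_nonneg fun e _ => hm0 _ _
  have hq1 : ∑ D, q D = 1 := by
    rw [hq, sum_prod_entry]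
    simp only [hm1, Finset.prod_const_one]
  have hqc : Consistent Ts α q := by
    refine ⟨⟨hq0, hq1⟩, fun T hT => ?_⟩
    rw [← hpT T hT, freqP_eq, freqP_eq]
    simp only [hqm]
  have hle : ∀ D e, p D ≤ marginal p e (D e.1 e.2) := fun D e => by
    have := Finset.single_le_sum (s := Finset.univ)
      (f := fun D' : Dataset n m => if D' e.1 e.2 = D e.1 e.2 then p D' else 0)
      (fun D' _ => by split_ifs <;> simp [hp0]) (Finset.mem_univ D)
    simpa [marginal] using this
  have hac : ∀ D, q D = 0 → p D = 0 := fun D h => by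
    obtain ⟨e, _, he⟩ := Finset.prod_eq_zero_iff.1 h
    exact le_antisymm (he ▸ hle D e) (hp0 D)
  have hcross : ∀ r : Dataset n m → ℝ, (∀ D, q D = 0 → r D = 0) →
      ∑ D, r D * Real.log (q D) = ∑ e, ∑ v, marginal r e v * Real.log (marginal p e v) := by
    intro r hr
    have : ∀ D, r D * Real.log (q D)
        = ∑ e : Fin n × Fin m, r D * Real.log (marginal p e (D e.1 e.2)) := fun D => by
      by_cases h : q D = 0
      · simp [hr D h]
      · rw [← Finset.mul_sum, hq, Real.log_prod]
        exact fun e he => Finset.prod_ne_zero_iff.1 h e he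
    rw [Finset.sum_congr rfl fun D _ => this D, Finset.sum_comm]
    exact Finset.sum_congr rfl fun e _ =>
      sum_mul_entry r e (fun v => Real.log (marginal p e v))
  have hEq : ∑ D, q D * Real.log (q D) = ∑ D, p D * Real.log (q D) := by
    rw [hcross q fun _ h => h, hcross p hac]
    simp only [hqm]
  have hH := hmax q hqc
  unfold entropy at hH
  have hg := fun D => gibbs_term (p D) (q D) (hp0 D) (hq0 D) (hac D)
  have hs : ∑ D, (p D * Real.log (p D) - p D * Real.log (q D) - p D + q D) = 0 := by
    refine le_antisymm ?_ (Finset.sum_nonneg fun D _ => (hg D).1)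
    rw [Finset.sum_add_distrib, Finset.sum_sub_distrib, Finset.sum_sub_distrib, hp1, hq1]
    linarith
  intro D
  exact (hg D).2 ((Finset.sum_eq_zero_iff_of_nonneg fun D _ => (hg D).1).1 hs D (Finset.mem_univ D))
end TileCompare
end

section
/- Let D_in be a fixed n×m binary dataset and 𝒯 a finite set of tiles, each with nonempty area and each exact with respect to D_in (i.e., α_T := freq(T;D_in) ∈ {0,1} for every T ∈ 𝒯). Define the product distribution p_𝒯 over 𝒟 by p_𝒯(D) = ∏_{(i,j)} μ_{ij}(D(i,j)), where μ_{ij}(1) = D_in(i,j) if (i,j) ∈ area(𝒯) and μ_{ij}(1) = 1/2 otherwise (and μ_{ij}(0) = 1 − μ_{ij}(1)). Then p_𝒯 is a maximum entropy distribution for (𝒯, α): p_𝒯 ∈ P(𝒯,α) and H(q) ≤ H(p_𝒯) for every q ∈ P(𝒯,α). -/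
open Finset

namespace TileCompare

variable {n m : ℕ}

theorem freqD_eq_zero_imp {n m : ℕ} (T : Tile n m) (D : Dataset n m) (hT : (area T).Nonempty)
    (h : freqD T D = 0) : ∀ e ∈ area T, D e.1 e.2 = false := by
  have hc : ((area T).card : ℝ) ≠ 0 := by
    have := hT.card_pos
    positivity
  unfold freqD at h
  rw [div_eq_zero_iff, or_iff_left hc,
    Finset.sum_eq_zero_iff_of_nonneg (by intros; split_ifs <;> norm_num)] at h
  intro e he
  have := h e he
  by_contra hh
  simp_all

theorem freqD_eq_one_imp {n m : ℕ} (T : Tile n m) (D : Dataset n m) (hT : (area T).Nonempty)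
    (h : freqD T D = 1) : ∀ e ∈ area T, D e.1 e.2 = true := by
  have hc : ((area T).card : ℝ) ≠ 0 := by
    have := hT.card_pos
    positivity
  unfold freqD at h
  rw [div_eq_one_iff_eq hc] at h
  have h2 : ∑ e ∈ area T, (1 - if D e.1 e.2 then (1 : ℝ) else 0) = 0 := by
    rw [Finset.sum_sub_distrib, h]; simp
  rw [Finset.sum_eq_zero_iff_of_nonneg (by intros; split_ifs <;> norm_num)] at h2
  intro e he
  have := h2 e he
  by_contra hh
  simp_all

theorem freqD_nonneg {n m : ℕ} (T : Tile n m) (D : Dataset n m) : 0 ≤ freqD T D := by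
  unfold freqD
  refine div_nonneg (Finset.sum_nonneg ?_) (by positivity)
  intros; split_ifs <;> norm_num

theorem freqD_le_one {n m : ℕ} (T : Tile n m) (D : Dataset n m) : freqD T D ≤ 1 := by
  unfold freqD
  refine div_le_one_of_le₀ ?_ (by positivity)
  calc _ ≤ ∑ e ∈ area T, (1 : ℝ) := by
        refine Finset.sum_le_sum ?_
        intros; split_ifs <;> norm_num
    _ = _ := by simp

theorem prodDist_sum {n m : ℕ} (Din : Dataset n m) (Ts : Finset (Tile n m)) :
    ∑ D : Dataset n m, prodDist Din Ts D = 1 := by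
  have h1 : ∑ D : Dataset n m, prodDist Din Ts D
      = ∑ f : Fin n × Fin m → Bool, ∏ e, mu Din Ts e (f e) := by
    refine Fintype.sum_equiv (Equiv.curry (Fin n) (Fin m) Bool).symm _ _ ?_
    intro D
    rfl
  rw [h1, ← Fintype.prod_sum]
  refine Finset.prod_eq_one ?_
  intro e _
  rw [Fintype.sum_bool]
  unfold mu
  split_ifs <;> simp_all
  norm_num

theorem prodDist_eq {n m : ℕ} (Din : Dataset n m) (Ts : Finset (Tile n m)) :
    ∃ c : ℝ, 0 < c ∧ (∀ D, (∀ e ∈ areaSet Ts, D e.1 e.2 = Din e.1 e.2) → prodDist Din Ts D = c)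
      ∧ ∀ D, ¬ (∀ e ∈ areaSet Ts, D e.1 e.2 = Din e.1 e.2) → prodDist Din Ts D = 0 := by
  refine ⟨∏ e : Fin n × Fin m, if e ∈ areaSet Ts then (1 : ℝ) else 1 / 2, ?_, ?_, ?_⟩
  · refine Finset.prod_pos ?_
    intros; split_ifs <;> norm_num
  · intro D hD
    refine Finset.prod_congr rfl ?_
    intro e _
    unfold mu
    split_ifs with h1 h2
    · rfl
    · exact absurd (hD e h1).symm h2
    · rfl
  · intro D hD
    push Not at hD
    obtain ⟨e, he, hne⟩ := hD
    refine Finset.prod_eq_zero (Finset.mem_univ e) ?_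
    unfold mu
    rw [if_pos he, if_neg (Ne.symm hne)]

theorem consistent_support {n m : ℕ} (Din : Dataset n m) (Ts : Finset (Tile n m))
    (hne : ∀ T ∈ Ts, (area T).Nonempty)
    (hexact : ∀ T ∈ Ts, freqD T Din = 0 ∨ freqD T Din = 1) (q : Dataset n m → ℝ)
    (hq : Consistent Ts (fun T => freqD T Din) q) (D : Dataset n m) (hD : q D ≠ 0) :
    ∀ e ∈ areaSet Ts, D e.1 e.2 = Din e.1 e.2 := by
  intro e he
  obtain ⟨⟨hq0, hq1⟩, hqT⟩ := hq
  obtain ⟨T, hT, heT⟩ := Finset.mem_biUnion.1 he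
  have hf := hqT T hT
  simp only [freqP] at hf
  rcases hexact T hT with h | h
  · rw [h, Finset.sum_eq_zero_iff_of_nonneg
      (fun D _ => mul_nonneg (hq0 D) (freqD_nonneg T D))] at hf
    have h3 := (mul_eq_zero.1 (hf D (Finset.mem_univ D))).resolve_left hD
    rw [freqD_eq_zero_imp T D (hne T hT) h3 e heT, freqD_eq_zero_imp T Din (hne T hT) h e heT]
  · have h2 : ∑ D, q D * (1 - freqD T D) = 0 := by
      simp only [mul_sub, mul_one]
      rw [Finset.sum_sub_distrib, hf, hq1, h, sub_self]
    rw [Finset.sum_eq_zero_iff_of_nonneg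
      (fun D _ => mul_nonneg (hq0 D) (sub_nonneg.2 (freqD_le_one T D)))] at h2
    have h3 := (mul_eq_zero.1 (h2 D (Finset.mem_univ D))).resolve_left hD
    have h4 : freqD T D = 1 := by linarith
    rw [freqD_eq_one_imp T D (hne T hT) h4 e heT, freqD_eq_one_imp T Din (hne T hT) h e heT]

/-- For a set of tiles exact w.r.t. a dataset `Din`, the product distribution
with entry marginals given by `Din` on covered entries and `1/2` elsewhere is a maximum
entropy distribution for the corresponding constraints. -/
theorem prodDist_isMaxEnt {n m : ℕ} (Din : Dataset n m) (Ts : Finset (Tile n m))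
    (hne : ∀ T ∈ Ts, (area T).Nonempty)
    (hexact : ∀ T ∈ Ts, freqD T Din = 0 ∨ freqD T Din = 1) :
    IsMaxEnt Ts (fun T => freqD T Din) (prodDist Din Ts) := by
  obtain ⟨c, hc, hin, hout⟩ := prodDist_eq Din Ts
  have hsum := prodDist_sum Din Ts
  have hp0 : ∀ D, 0 ≤ prodDist Din Ts D := by
    intro D
    by_cases hD : ∀ e ∈ areaSet Ts, D e.1 e.2 = Din e.1 e.2
    · rw [hin D hD]; exact hc.le
    · rw [hout D hD]
  refine ⟨⟨⟨hp0, hsum⟩, ?_⟩, ?_⟩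
  · intro T hT
    have : ∀ D, prodDist Din Ts D * freqD T D = prodDist Din Ts D * freqD T Din := by
      intro D
      by_cases hD : ∀ e ∈ areaSet Ts, D e.1 e.2 = Din e.1 e.2
      · congr 1
        unfold freqD
        congr 1
        refine Finset.sum_congr rfl ?_
        intro e he
        rw [hD e (Finset.mem_biUnion.2 ⟨T, hT, he⟩)]
      · rw [hout D hD]; simp
    simp only [freqP, this]
    rw [← Finset.sum_mul, hsum, one_mul]
  · intro q hq
    have hsupp := consistent_support Din Ts hne hexact q hq
    obtain ⟨⟨hq0, hq1⟩, -⟩ := hq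
    have hP : ∑ D, prodDist Din Ts D * Real.log (prodDist Din Ts D) = Real.log c := by
      have : ∀ D, prodDist Din Ts D * Real.log (prodDist Din Ts D)
          = prodDist Din Ts D * Real.log c := by
        intro D
        by_cases hD : ∀ e ∈ areaSet Ts, D e.1 e.2 = Din e.1 e.2
        · rw [hin D hD]
        · rw [hout D hD]; simp
      simp only [this]
      rw [← Finset.sum_mul, hsum, one_mul]
    have hQ : ∑ D, (q D * Real.log c + (q D - prodDist Din Ts D))
        ≤ ∑ D, q D * Real.log (q D) := by
      refine Finset.sum_le_sum ?_
      intro D _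
      by_cases hD : q D = 0
      · have := hp0 D
        simp [hD, this]
      · have hpos : 0 < q D := lt_of_le_of_ne (hq0 D) (Ne.symm hD)
        rw [hin D (hsupp D hD)]
        have h1 := Real.log_le_sub_one_of_pos (div_pos hc hpos)
        rw [Real.log_div hc.ne' hD] at h1
        have h2 := mul_le_mul_of_nonneg_left h1 hpos.le
        have h3 : q D * (c / q D - 1) = c - q D := by field_simp
        rw [h3] at h2
        linarith
    rw [Finset.sum_add_distrib, Finset.sum_sub_distrib, ← Finset.sum_mul, hq1, hsum] at hQ
    unfold entropy
    rw [hP]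
    linarith
end TileCompare
end

section
/- Let D_in be a fixed n×m binary dataset and let 𝒯, 𝒰, ℬ be finite collections of tiles, each tile with nonempty area and exact with respect to D_in. Define X = area(𝒯) \ area(ℬ) and Y = area(𝒰) \ area(ℬ), and let d(𝒯,𝒰;ℬ) be the distance computed from the product distributions p_{𝒯∪𝒰∪ℬ}, p_{𝒯∪ℬ}, p_{𝒰∪ℬ}, p_ℬ. Then d(𝒯,𝒰;ℬ) = 1 − |X ∩ Y| / |X ∪ Y| if |X ∪ Y| > 0, and d(𝒯,𝒰;ℬ) = 1 if |X ∪ Y| = 0. -/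
open Finset

namespace TileCompare

variable {n m : ℕ}

lemma sum_prodDist (Din : Dataset n m) (Ts : Finset (Tile n m)) :
    ∑ D : Dataset n m, prodDist Din Ts D = 1 := by
  have h1 : ∑ D : Dataset n m, prodDist Din Ts D
      = ∑ x : Fin n × Fin m → Bool, ∏ e : Fin n × Fin m, mu Din Ts e (x e) := by
    symm
    refine Fintype.sum_equiv (Equiv.curry (Fin n) (Fin m) Bool) _ _ ?_
    intro x
    rfl
  have h2 := Finset.prod_univ_sum (fun _ : Fin n × Fin m => (Finset.univ : Finset Bool))
    (fun e v => mu Din Ts e v)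
  rw [Fintype.piFinset_univ] at h2
  rw [h1, ← h2]
  apply Finset.prod_eq_one
  intro e _
  rw [Fintype.sum_bool]
  unfold mu
  by_cases he : e ∈ areaSet Ts
  · cases hD : Din e.1 e.2 <;> simp [he]
  · simp only [he, if_false]
    norm_num

lemma KL_prodDist (Din : Dataset n m) (Ms As : Finset (Tile n m))
    (hsub : areaSet As ⊆ areaSet Ms) :
    KL (prodDist Din Ms) (prodDist Din As)
      = ((areaSet Ms \ areaSet As).card : ℝ) * Real.log 2 := by
  have key : ∀ D : Dataset n m,
      prodDist Din Ms D * Real.log (prodDist Din Ms D / prodDist Din As D)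
      = prodDist Din Ms D * (((areaSet Ms \ areaSet As).card : ℝ) * Real.log 2) := by
    intro D
    by_cases h0 : prodDist Din Ms D = 0
    · simp [h0]
    · congr 1
      have hag : ∀ e ∈ areaSet Ms, Din e.1 e.2 = D e.1 e.2 := by
        intro e he
        by_contra hcon
        apply h0
        unfold prodDist
        apply Finset.prod_eq_zero (Finset.mem_univ e)
        simp [mu, he, hcon]
      have hr : prodDist Din Ms D / prodDist Din As D
          = ∏ e : Fin n × Fin m, if e ∈ areaSet Ms \ areaSet As then (2 : ℝ) else 1 := by
        unfold prodDist
        rw [← Finset.prod_div_distrib]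
        apply Finset.prod_congr rfl
        intro e _
        unfold mu
        by_cases hM : e ∈ areaSet Ms
        · have := hag e hM
          by_cases hA : e ∈ areaSet As
          · simp [hM, hA, this]
          · simp [hM, hA, this]
        · have hA : e ∉ areaSet As := fun h => hM (hsub h)
          simp [hM, hA]
      rw [hr, Finset.prod_ite_mem, Finset.univ_inter, Finset.prod_const, Real.log_pow]
  unfold KL
  rw [Finset.sum_congr rfl (fun D _ => key D), ← Finset.sum_mul, sum_prodDist, one_mul]

lemma areaSet_union (As Cs : Finset (Tile n m)) :
    areaSet (As ∪ Cs) = areaSet As ∪ areaSet Cs := by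
  unfold areaSet
  exact Finset.union_biUnion

/-- For exact tile collections `Ts`, `Us`, `Bs`, the distance `d(Ts,Us;Bs)`
equals the Jaccard dissimilarity of `X = area(Ts) \ area(Bs)` and `Y = area(Us) \ area(Bs)`
when `X ∪ Y` is nonempty, and equals `1` when `X ∪ Y` is empty. -/
theorem dist_eq_jaccard {n m : ℕ} (Din : Dataset n m) (Ts Us Bs : Finset (Tile n m))
    (hne : ∀ T ∈ Ts ∪ Us ∪ Bs, (area T).Nonempty)
    (hex : ∀ T ∈ Ts ∪ Us ∪ Bs, freqD T Din = 0 ∨ freqD T Din = 1) :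
    (0 < ((areaSet Ts \ areaSet Bs) ∪ (areaSet Us \ areaSet Bs)).card →
      distE Din Ts Us Bs
        = 1 - (((areaSet Ts \ areaSet Bs) ∩ (areaSet Us \ areaSet Bs)).card : ℝ)
            / ((((areaSet Ts \ areaSet Bs) ∪ (areaSet Us \ areaSet Bs))).card : ℝ)) ∧
    (((areaSet Ts \ areaSet Bs) ∪ (areaSet Us \ areaSet Bs)).card = 0 →
      distE Din Ts Us Bs = 1) := by
  have hlog : Real.log 2 ≠ 0 := (Real.log_pos one_lt_two).ne'
  set X := areaSet Ts \ areaSet Bs with hX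
  set Y := areaSet Us \ areaSet Bs with hY
  have e1 : areaSet (Ts ∪ Us ∪ Bs) \ areaSet Bs = X ∪ Y := by
    ext e; simp only [areaSet_union, hX, hY, Finset.mem_sdiff, Finset.mem_union]; tauto
  have e2 : areaSet (Ts ∪ Us ∪ Bs) \ areaSet (Us ∪ Bs) = X \ Y := by
    ext e; simp only [areaSet_union, hX, hY, Finset.mem_sdiff, Finset.mem_union]; tauto
  have e3 : areaSet (Ts ∪ Us ∪ Bs) \ areaSet (Ts ∪ Bs) = Y \ X := by
    ext e; simp only [areaSet_union, hX, hY, Finset.mem_sdiff, Finset.mem_union]; tauto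
  have k1 := KL_prodDist Din (Ts ∪ Us ∪ Bs) Bs (by
    intro e; simp only [areaSet_union, Finset.mem_union]; tauto)
  have k2 := KL_prodDist Din (Ts ∪ Us ∪ Bs) (Us ∪ Bs) (by
    intro e; simp only [areaSet_union, Finset.mem_union]; tauto)
  have k3 := KL_prodDist Din (Ts ∪ Us ∪ Bs) (Ts ∪ Bs) (by
    intro e; simp only [areaSet_union, Finset.mem_union]; tauto)
  rw [e1] at k1
  rw [e2] at k2
  rw [e3] at k3
  unfold distE
  rw [k1, k2, k3]
  constructor
  · intro hpos
    have hc : ((X ∪ Y).card : ℝ) ≠ 0 := by exact_mod_cast hpos.ne'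
    have c1 : ((X \ Y).card : ℝ) + (X ∩ Y).card = X.card := by
      exact_mod_cast Finset.card_sdiff_add_card_inter X Y
    have c2 : ((Y \ X).card : ℝ) + (X ∩ Y).card = Y.card := by
      rw [Finset.inter_comm X Y]
      exact_mod_cast Finset.card_sdiff_add_card_inter Y X
    have c3 : ((X ∪ Y).card : ℝ) + (X ∩ Y).card = X.card + Y.card := by
      exact_mod_cast Finset.card_union_add_card_inter X Y
    rw [if_neg (mul_ne_zero hc hlog), ← add_mul, mul_div_mul_right _ _ hlog,
      eq_sub_iff_add_eq, ← add_div, div_eq_one_iff_eq hc]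
    linarith
  · intro h0
    simp [h0]
end TileCompare
end

section
/- Let D_in be a fixed n×m binary dataset and let 𝒯, 𝒰, ℬ be finite collections of tiles, each tile with nonempty area and exact with respect to D_in. Then the distance computed from the corresponding product distributions satisfies d(𝒯,𝒰;ℬ) ≤ 1. -/
open Finset

namespace TileCompare

variable {n m : ℕ}

/-- On the support of the distribution of a larger tile set, the log-probability of a smaller
tile set is a sum of entrywise contributions. -/
lemma log_prodDist (Din : Dataset n m) (Ms Xs : Finset (Tile n m)) (hsub : Xs ⊆ Ms)
    (D : Dataset n m) (hD : prodDist Din Ms D ≠ 0) :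
    prodDist Din Xs D ≠ 0 ∧ Real.log (prodDist Din Xs D)
      = ∑ e : Fin n × Fin m, if e ∈ areaSet Xs then (0 : ℝ) else -Real.log 2 := by
  have hmu : ∀ e : Fin n × Fin m, mu Din Xs e (D e.1 e.2)
      = if e ∈ areaSet Xs then (1 : ℝ) else 1 / 2 := by
    intro e
    have he := Finset.prod_ne_zero_iff.mp hD e (Finset.mem_univ e)
    unfold mu at he ⊢
    by_cases hX : e ∈ areaSet Xs
    · have hM : e ∈ areaSet Ms := Finset.biUnion_subset_biUnion_of_subset_left _ hsub hX
      rw [if_pos hM] at he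
      rw [if_pos hX, if_pos hX]
      by_contra hc
      apply he
      apply if_neg
      intro h
      exact hc (if_pos h)
    · rw [if_neg hX, if_neg hX]
  have hne : ∀ e ∈ (Finset.univ : Finset (Fin n × Fin m)), mu Din Xs e (D e.1 e.2) ≠ 0 := by
    intro e _
    rw [hmu]
    split_ifs <;> norm_num
  refine ⟨Finset.prod_ne_zero_iff.mpr hne, ?_⟩
  unfold prodDist
  rw [Real.log_prod hne]
  refine Finset.sum_congr rfl fun e _ => ?_
  rw [hmu]
  split_ifs <;> simp

lemma prodDist_nonneg (Din : Dataset n m) (Xs : Finset (Tile n m)) (D : Dataset n m) :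
    0 ≤ prodDist Din Xs D := by
  refine Finset.prod_nonneg fun e _ => ?_
  unfold mu
  split_ifs <;> norm_num

/-- For exact tile collections the distance is bounded by `1`. -/
theorem dist_le_one {n m : ℕ} (Din : Dataset n m) (Ts Us Bs : Finset (Tile n m))
    (hne : ∀ T ∈ Ts ∪ Us ∪ Bs, (area T).Nonempty)
    (hex : ∀ T ∈ Ts ∪ Us ∪ Bs, freqD T Din = 0 ∨ freqD T Din = 1) :
    distE Din Ts Us Bs ≤ 1 := by
  have hl2 : 0 < Real.log 2 := Real.log_pos (by norm_num)
  set M := Ts ∪ Us ∪ Bs with hM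
  have hB : Bs ⊆ M := Finset.subset_union_right
  have hUB : Us ∪ Bs ⊆ M := by intro x; simp only [hM, Finset.mem_union]; tauto
  have hTB : Ts ∪ Bs ⊆ M := by intro x; simp only [hM, Finset.mem_union]; tauto
  have key : KL (prodDist Din M) (prodDist Din (Us ∪ Bs))
      + KL (prodDist Din M) (prodDist Din (Ts ∪ Bs))
      ≤ KL (prodDist Din M) (prodDist Din Bs) := by
    unfold KL
    rw [← Finset.sum_add_distrib]
    refine Finset.sum_le_sum fun D _ => ?_
    by_cases hD : prodDist Din M D = 0
    · simp [hD]
    · obtain ⟨h1, e1⟩ := log_prodDist Din M Bs hB D hD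
      obtain ⟨h2, e2⟩ := log_prodDist Din M (Us ∪ Bs) hUB D hD
      obtain ⟨h3, e3⟩ := log_prodDist Din M (Ts ∪ Bs) hTB D hD
      obtain ⟨-, e4⟩ := log_prodDist Din M M (Finset.Subset.refl _) D hD
      rw [← mul_add]
      refine mul_le_mul_of_nonneg_left ?_ (prodDist_nonneg Din M D)
      rw [Real.log_div hD h1, Real.log_div hD h2, Real.log_div hD h3, e1, e2, e3, e4]
      simp only [← Finset.sum_sub_distrib, ← Finset.sum_add_distrib]
      refine Finset.sum_le_sum fun e _ => ?_
      simp only [hM, areaSet, Finset.union_biUnion, Finset.mem_union]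
      by_cases a : e ∈ Ts.biUnion area <;> by_cases b : e ∈ Us.biUnion area <;>
        by_cases c : e ∈ Bs.biUnion area <;> simp only [a, b, c, or_true, true_or, or_false,
          or_self, if_true, if_false] <;> linarith
  have hnn : 0 ≤ KL (prodDist Din M) (prodDist Din Bs) := by
    unfold KL
    refine Finset.sum_nonneg fun D _ => ?_
    by_cases hD : prodDist Din M D = 0
    · simp [hD]
    · obtain ⟨h1, e1⟩ := log_prodDist Din M Bs hB D hD
      obtain ⟨-, e4⟩ := log_prodDist Din M M (Finset.Subset.refl _) D hD
      refine mul_nonneg (prodDist_nonneg Din M D) ?_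
      rw [Real.log_div hD h1, e1, e4, ← Finset.sum_sub_distrib]
      refine Finset.sum_nonneg fun e _ => ?_
      have hs : e ∈ areaSet Bs → e ∈ areaSet M :=
        fun h => Finset.biUnion_subset_biUnion_of_subset_left _ hB h
      split_ifs with p q q
      · linarith
      · linarith
      · exact absurd (hs q) p
      · linarith
  unfold distE
  split_ifs with h
  · exact le_refl _
  · exact div_le_one_of_le₀ key hnn
end TileCompare
end

section
/- Let 𝒯, 𝒰, ℬ be finite tile sets (each tile with nonempty area) with target frequencies all computed from a single dataset D_in, let 𝓜 = 𝒯∪𝒰∪ℬ, and let p_𝓜, p_{𝒯∪ℬ}, p_{𝒰∪ℬ}, p_ℬ be maximum entropy distributions for the respective tile sets. Assume that KL(p_𝓜‖p_X) = H(p_X) − H(p_𝓜) for X ∈ {𝒯∪ℬ, 𝒰∪ℬ, ℬ}. Then d(𝒯,𝒰;ℬ) ≤ 2. -/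
open Finset

namespace TileCompare

variable {n m : ℕ}

/-- Under the assumption that the KL divergences from the joint maximum
entropy model equal the corresponding entropy differences, the distance is at most `2`. -/
theorem dist_le_two {n m : ℕ} (Din : Dataset n m) (Ts Us Bs : Finset (Tile n m))
    (hne : ∀ T ∈ Ts ∪ Us ∪ Bs, (area T).Nonempty)
    (pM pTB pUB pB : Dataset n m → ℝ)
    (hM : IsMaxEnt (Ts ∪ Us ∪ Bs) (fun T => freqD T Din) pM)
    (hTB : IsMaxEnt (Ts ∪ Bs) (fun T => freqD T Din) pTB)
    (hUB : IsMaxEnt (Us ∪ Bs) (fun T => freqD T Din) pUB)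
    (hB : IsMaxEnt Bs (fun T => freqD T Din) pB)
    (hklTB : KL pM pTB = entropy pTB - entropy pM)
    (hklUB : KL pM pUB = entropy pUB - entropy pM)
    (hklB : KL pM pB = entropy pB - entropy pM) :
    distKL pM pTB pUB pB ≤ 2 := by
  have mono : ∀ (A : Finset (Tile n m)) (p : Dataset n m → ℝ), Bs ⊆ A →
      IsMaxEnt A (fun T => freqD T Din) p → entropy p ≤ entropy pB := by
    intro A p hA hp
    exact hB.2 p ⟨hp.1.1, fun T hT => hp.1.2 T (hA hT)⟩
  have h1 := mono _ _ Finset.subset_union_right hTB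
  have h2 := mono _ _ Finset.subset_union_right hUB
  have h3 := mono _ _ Finset.subset_union_right hM
  unfold distKL
  split_ifs with h
  · norm_num
  · have hpos : 0 < KL pM pB := lt_of_le_of_ne (by rw [hklB]; linarith) (Ne.symm h)
    rw [div_le_iff₀ hpos]
    linarith
end TileCompare
end

section
/- Let 𝒯, 𝒰, ℬ be finite tile sets (each tile with nonempty area) with target frequencies all computed from a single dataset D_in, where every tile in ℬ is exact (freq(T;D_in) ∈ {0,1} for all T ∈ ℬ) and area(𝒯) ∩ area(𝒰) ⊆ area(ℬ). Then the distance computed from maximum entropy distributions for 𝓜 = 𝒯∪𝒰∪ℬ, 𝒯∪ℬ, 𝒰∪ℬ, and ℬ satisfies d(𝒯,𝒰;ℬ) = 1. -/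
open Finset

namespace TileCompare

variable {n m : ℕ}

noncomputable def mg (p : Dataset n m → ℝ) (e : Fin n × Fin m) : ℝ :=
  ∑ D : Dataset n m, p D * (if D e.1 e.2 then (1 : ℝ) else 0)

lemma freqP_eq_mg (T : Tile n m) (p : Dataset n m → ℝ) :
    freqP T p = (∑ e ∈ area T, mg p e) / ((area T).card : ℝ) := by
  unfold freqP freqD mg
  rw [Finset.sum_comm, Finset.sum_div]
  refine Finset.sum_congr rfl fun D _ => ?_
  rw [← Finset.mul_sum, mul_div_assoc]

lemma mg_mem {p : Dataset n m → ℝ} (hp : IsDistribution p) (e : Fin n × Fin m) :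
    0 ≤ mg p e ∧ mg p e ≤ 1 := by
  constructor
  · refine Finset.sum_nonneg fun D _ => mul_nonneg (hp.1 D) ?_
    split_ifs <;> norm_num
  · rw [← hp.2]
    refine Finset.sum_le_sum fun D _ => ?_
    have := hp.1 D
    split_ifs <;> simp [this]

lemma exact_aux {ι : Type*} (s : Finset ι) (x y : ι → ℝ)
    (hx : ∀ e ∈ s, 0 ≤ x e ∧ x e ≤ 1) (hy : ∀ e ∈ s, 0 ≤ y e ∧ y e ≤ 1)
    (hxy : (∑ e ∈ s, x e) / (s.card : ℝ) = (∑ e ∈ s, y e) / (s.card : ℝ))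
    (h : (∑ e ∈ s, y e) / (s.card : ℝ) = 0 ∨ (∑ e ∈ s, y e) / (s.card : ℝ) = 1) :
    ∀ e ∈ s, x e = y e := by
  intro e he
  have hc : (s.card : ℝ) ≠ 0 := by
    have := Finset.card_pos.mpr ⟨e, he⟩
    positivity
  have key0 : ∀ z : ι → ℝ, (∀ e ∈ s, 0 ≤ z e ∧ z e ≤ 1) →
      (∑ e ∈ s, z e) / (s.card : ℝ) = 0 → z e = 0 := by
    intro z hz h0
    have h1 : ∑ e ∈ s, z e = 0 := by
      rcases div_eq_zero_iff.mp h0 with h | h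
      · exact h
      · exact absurd h hc
    exact (Finset.sum_eq_zero_iff_of_nonneg fun e he => (hz e he).1).mp h1 e he
  have key1 : ∀ z : ι → ℝ, (∀ e ∈ s, 0 ≤ z e ∧ z e ≤ 1) →
      (∑ e ∈ s, z e) / (s.card : ℝ) = 1 → z e = 1 := by
    intro z hz h0
    have h1 : ∑ e ∈ s, z e = s.card := by
      rwa [div_eq_one_iff_eq hc] at h0
    have h2 : ∑ e ∈ s, (1 - z e) = 0 := by
      rw [Finset.sum_sub_distrib, h1]; simp
    have := (Finset.sum_eq_zero_iff_of_nonneg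
      fun e he => sub_nonneg.mpr (hz e he).2).mp h2 e he
    linarith
  rcases h with h | h
  · rw [key0 x hx (hxy.trans h), key0 y hy h]
  · rw [key1 x hx (hxy.trans h), key1 y hy h]

lemma mg_exact (Din : Dataset n m) (Bs : Finset (Tile n m))
    (hexB : ∀ T ∈ Bs, freqD T Din = 0 ∨ freqD T Din = 1)
    {p : Dataset n m → ℝ} (hp : Consistent Bs (fun T => freqD T Din) p)
    {e : Fin n × Fin m} (he : e ∈ areaSet Bs) :
    mg p e = if Din e.1 e.2 then (1 : ℝ) else 0 := by
  obtain ⟨T, hT, heT⟩ := Finset.mem_biUnion.mp he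
  refine exact_aux (area T) (mg p) (fun e => if Din e.1 e.2 then (1 : ℝ) else 0)
    (fun e _ => mg_mem hp.1 e) (fun e _ => by split_ifs <;> norm_num) ?_ (hexB T hT) e heT
  rw [← freqP_eq_mg]
  exact hp.2 T hT

/-! Mixing two datasets. -/

def mix (A : Finset (Fin n × Fin m)) (D E : Dataset n m) : Dataset n m :=
  fun i j => if (i, j) ∈ A then D i j else E i j

lemma mix_mix (A : Finset (Fin n × Fin m)) (D E : Dataset n m) :
    mix A (mix A D E) (mix A E D) = D := by
  funext i j
  unfold mix
  split_ifs <;> rfl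

def swapEquiv (A : Finset (Fin n × Fin m)) :
    (Dataset n m × Dataset n m) ≃ (Dataset n m × Dataset n m) where
  toFun x := (mix A x.1 x.2, mix A x.2 x.1)
  invFun x := (mix A x.1 x.2, mix A x.2 x.1)
  left_inv x := by simp [mix_mix]
  right_inv x := by simp [mix_mix]

noncomputable def joint (A : Finset (Fin n × Fin m)) (p r : Dataset n m → ℝ)
    (D E : Dataset n m) : ℝ := p (mix A D E) * r (mix A E D)

noncomputable def glue (A : Finset (Fin n × Fin m)) (p r : Dataset n m → ℝ)
    (D : Dataset n m) : ℝ := ∑ E, joint A p r D E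

lemma joint_sum (A : Finset (Fin n × Fin m)) (p r : Dataset n m → ℝ)
    (f : Dataset n m → Dataset n m → ℝ) :
    ∑ D, ∑ E, joint A p r D E * f D E
      = ∑ D, ∑ E, p D * r E * f (mix A D E) (mix A E D) := by
  rw [← Fintype.sum_prod_type', ← Fintype.sum_prod_type']
  refine Fintype.sum_equiv (swapEquiv A) _ _ fun x => ?_
  simp [swapEquiv, joint, mix_mix]

lemma joint_swap (A : Finset (Fin n × Fin m)) (p r : Dataset n m → ℝ) (E : Dataset n m) :
    ∑ D, joint A p r D E = glue A r p E := by
  unfold glue joint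
  exact Finset.sum_congr rfl fun D _ => mul_comm _ _

lemma glue_sum (A : Finset (Fin n × Fin m)) (p r : Dataset n m → ℝ) (f : Dataset n m → ℝ) :
    ∑ D, glue A p r D * f D = ∑ D, ∑ E, p D * r E * f (mix A D E) := by
  rw [← joint_sum A p r (fun D _ => f D)]
  exact Finset.sum_congr rfl fun D _ => by rw [glue, Finset.sum_mul]

lemma glue_dist (A : Finset (Fin n × Fin m)) {p r : Dataset n m → ℝ}
    (hp : IsDistribution p) (hr : IsDistribution r) : IsDistribution (glue A p r) := by
  constructor
  · exact fun D => Finset.sum_nonneg fun E _ => mul_nonneg (hp.1 _) (hr.1 _)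
  · have := glue_sum A p r (fun _ => 1)
    simp only [mul_one] at this
    rw [this, ← Finset.sum_mul_sum, hp.2, hr.2, one_mul]

lemma mg_glue (A : Finset (Fin n × Fin m)) {p r : Dataset n m → ℝ}
    (hp : IsDistribution p) (hr : IsDistribution r) (e : Fin n × Fin m) :
    mg (glue A p r) e = if e ∈ A then mg p e else mg r e := by
  unfold mg
  rw [glue_sum A p r (fun D => if D e.1 e.2 then (1 : ℝ) else 0)]
  by_cases he : e ∈ A
  · simp only [mix, he, if_true]
    refine Finset.sum_congr rfl fun D _ => ?_
    rw [← Finset.sum_mul, ← Finset.mul_sum, hr.2, mul_one]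
  · simp only [mix, he, if_false]
    rw [Finset.sum_comm]
    refine Finset.sum_congr rfl fun D _ => ?_
    rw [← Finset.sum_mul, ← Finset.sum_mul, hp.2, one_mul]

lemma subadd {α β : Type*} [Fintype α] [Fintype β] (P : α → β → ℝ) (hP : ∀ a b, 0 ≤ P a b)
    (h1 : ∑ a, ∑ b, P a b = 1) :
    ∑ a, (∑ b, P a b) * Real.log (∑ b, P a b) + ∑ b, (∑ a, P a b) * Real.log (∑ a, P a b)
      ≤ ∑ a, ∑ b, P a b * Real.log (P a b) := by
  set u : α → ℝ := fun a => ∑ b, P a b with hu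
  set v : β → ℝ := fun b => ∑ a, P a b with hv
  have e1 : ∑ a, u a * Real.log (u a) = ∑ a, ∑ b, P a b * Real.log (u a) :=
    Finset.sum_congr rfl fun a _ => by rw [← Finset.sum_mul]
  have e2 : ∑ b, v b * Real.log (v b) = ∑ a, ∑ b, P a b * Real.log (v b) := by
    rw [Finset.sum_comm]
    exact Finset.sum_congr rfl fun a _ => by rw [← Finset.sum_mul]
  have e3 : ∑ a, ∑ b, (P a b - u a * v b) = 0 := by
    simp only [Finset.sum_sub_distrib]
    have hv1 : ∑ b, v b = 1 := by rw [← h1, Finset.sum_comm]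
    rw [← Finset.sum_mul_sum, hv1, h1]
    norm_num
  have key : ∀ a b, P a b * Real.log (u a) + P a b * Real.log (v b) + (P a b - u a * v b)
      ≤ P a b * Real.log (P a b) := by
    intro a b
    have hua : P a b ≤ u a := Finset.single_le_sum (fun b _ => hP a b) (Finset.mem_univ b)
    have hvb : P a b ≤ v b :=
      Finset.single_le_sum (f := fun a => P a b) (fun a _ => hP a b) (Finset.mem_univ a)
    rcases (hP a b).eq_or_lt with h0 | h0
    · rw [← h0] at hua hvb ⊢
      have := mul_nonneg hua hvb
      simp; exact this
    · have hu0 := h0.trans_le hua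
      have hv0 := h0.trans_le hvb
      have := Real.log_le_sub_one_of_pos (div_pos (mul_pos hu0 hv0) h0)
      rw [Real.log_div (mul_pos hu0 hv0).ne' h0.ne', Real.log_mul hu0.ne' hv0.ne'] at this
      have h2 := mul_le_mul_of_nonneg_left this h0.le
      have h3 : P a b * (u a * v b / P a b - 1) = u a * v b - P a b := by
        field_simp
      rw [h3] at h2
      linarith
  have hs := Finset.sum_le_sum fun a (_ : a ∈ Finset.univ) =>
    Finset.sum_le_sum fun b (_ : b ∈ Finset.univ) => key a b
  simp only [Finset.sum_add_distrib] at hs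
  rw [e3] at hs
  rw [e1, e2]
  linarith

lemma entropy_glue (A : Finset (Fin n × Fin m)) {p r : Dataset n m → ℝ}
    (hp : IsDistribution p) (hr : IsDistribution r) :
    entropy p + entropy r ≤ entropy (glue A p r) + entropy (glue A r p) := by
  have h := subadd (joint A p r) (fun D E => mul_nonneg (hp.1 _) (hr.1 _)) (glue_dist A hp hr).2
  simp only [joint_swap] at h
  have h2 := joint_sum A p r (fun D E => Real.log (joint A p r D E))
  rw [h2] at h
  have h3 : ∑ D, ∑ E, p D * r E * Real.log (joint A p r (mix A D E) (mix A E D))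
      = ∑ D, p D * Real.log (p D) + ∑ E, r E * Real.log (r E) := by
    have : ∀ D E, p D * r E * Real.log (joint A p r (mix A D E) (mix A E D))
        = (p D * Real.log (p D)) * r E + p D * (r E * Real.log (r E)) := by
      intro D E
      rw [joint, mix_mix, mix_mix]
      by_cases h1 : p D = 0
      · simp [h1]
      by_cases h2 : r E = 0
      · simp [h2]
      rw [Real.log_mul h1 h2]; ring
    simp only [this, Finset.sum_add_distrib]
    rw [← Finset.sum_mul_sum, ← Finset.sum_mul_sum, hp.2, hr.2]; ring
  rw [h3] at h
  simp only [glue, entropy] at h ⊢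
  linarith

/-! Pythagorean identity. -/

lemma freqP_lin (T : Tile n m) (p q : Dataset n m → ℝ) (t : ℝ) :
    freqP T (fun D => p D + t * (q D - p D)) = freqP T p + t * (freqP T q - freqP T p) := by
  unfold freqP
  rw [← Finset.sum_sub_distrib, Finset.mul_sum, ← Finset.sum_add_distrib]
  exact Finset.sum_congr rfl fun D _ => by ring

lemma consistent_line {Ts : Finset (Tile n m)} {α : Tile n m → ℝ} {p q : Dataset n m → ℝ}
    (hp : Consistent Ts α p) (hq : Consistent Ts α q) (t : ℝ)
    (h0 : ∀ D, 0 ≤ p D + t * (q D - p D)) :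
    Consistent Ts α (fun D => p D + t * (q D - p D)) := by
  refine ⟨⟨h0, ?_⟩, fun T hT => ?_⟩
  · rw [Finset.sum_add_distrib, ← Finset.mul_sum, Finset.sum_sub_distrib, hp.1.2, hq.1.2]
    ring
  · rw [freqP_lin, hp.2 T hT, hq.2 T hT]; ring

lemma entropy_eq (p : Dataset n m → ℝ) : entropy p = ∑ D, Real.negMulLog (p D) := by
  simp [entropy, Real.negMulLog]

lemma supp_maxEnt {Ts : Finset (Tile n m)} {α : Tile n m → ℝ} {p q : Dataset n m → ℝ}
    (hp : IsMaxEnt Ts α p) (hq : Consistent Ts α q) (D : Dataset n m) (hD : p D = 0) :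
    q D = 0 := by
  by_contra hne
  have hq0 : 0 < q D := lt_of_le_of_ne (hq.1.1 D) (Ne.symm hne)
  have key : ∀ t : ℝ, 0 < t → t < 1 → - (q D) * Real.log t ≤ entropy p - entropy q := by
    intro t ht0 ht1
    have hnn : ∀ E, 0 ≤ p E + t * (q E - p E) := by
      intro E
      have := mul_nonneg ht0.le (hq.1.1 E)
      have := mul_nonneg (sub_pos.mpr ht1).le (hp.1.1.1 E)
      linarith
    have h1 := hp.2 _ (consistent_line hp.1 hq t hnn)
    have h2 : ∀ E, (1 - t) * Real.negMulLog (p E) + t * Real.negMulLog (q E)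
        + (if E = D then - (q D) * t * Real.log t else 0)
        ≤ Real.negMulLog (p E + t * (q E - p E)) := by
      intro E
      by_cases hE : E = D
      · subst hE
        rw [hD, if_pos rfl, zero_add, sub_zero, Real.negMulLog_mul]
        simp only [Real.negMulLog]
        simp
        apply le_of_eq; ring
      · rw [if_neg hE, add_zero]
        have := Real.concaveOn_negMulLog.2 (Set.mem_Ici.mpr (hp.1.1.1 E))
          (Set.mem_Ici.mpr (hq.1.1 E)) (sub_pos.mpr ht1).le ht0.le (by ring)
        simp only [smul_eq_mul] at this
        have he : p E + t * (q E - p E) = (1 - t) * p E + t * q E := by ring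
        rw [he]; exact this
    have h3 := Finset.sum_le_sum fun E (_ : E ∈ Finset.univ) => h2 E
    rw [Finset.sum_add_distrib, Finset.sum_add_distrib, ← Finset.mul_sum, ← Finset.mul_sum,
      ← entropy_eq, ← entropy_eq, ← entropy_eq (fun E => p E + t * (q E - p E))] at h3
    simp only [Finset.sum_ite_eq', Finset.mem_univ, if_true] at h3
    have h4 : t * (- (q D) * Real.log t) ≤ t * (entropy p - entropy q) := by linarith
    exact le_of_mul_le_mul_left h4 ht0
  set K := |entropy p - entropy q| + 1 with hK
  have hKpos : 0 < K := by positivity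
  have := key (Real.exp (-(K / q D))) (Real.exp_pos _)
    (by rw [← Real.exp_zero]; exact Real.exp_lt_exp.2 (by have := div_pos hKpos hq0; linarith))
  rw [Real.log_exp] at this
  have h5 : -(q D) * -(K / q D) = K := by field_simp
  rw [h5] at this
  have := le_abs_self (entropy p - entropy q)
  linarith

lemma cross_maxEnt {Ts : Finset (Tile n m)} {α : Tile n m → ℝ} {p q : Dataset n m → ℝ}
    (hp : IsMaxEnt Ts α p) (hq : Consistent Ts α q) :
    ∑ D, q D * Real.log (p D) = ∑ D, p D * Real.log (p D) := by
  have hd : HasDerivAt (fun t : ℝ => ∑ D, Real.negMulLog (p D + t * (q D - p D)))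
      (∑ D, (-Real.log (p D) - 1) * (q D - p D)) 0 := by
    refine HasDerivAt.fun_sum fun D _ => ?_
    by_cases hD : p D = 0
    · have hqD := supp_maxEnt hp hq D hD
      simp only [hD, hqD]
      simpa using hasDerivAt_const (0 : ℝ) (0 : ℝ)
    · have hl : HasDerivAt (fun t : ℝ => p D + t * (q D - p D)) (q D - p D) 0 := by
        simpa using ((hasDerivAt_id (0 : ℝ)).mul_const (q D - p D)).const_add (p D)
      have hn : HasDerivAt Real.negMulLog (-Real.log (p D) - 1) (p D + 0 * (q D - p D)) := by
        rw [zero_mul, add_zero]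
        exact Real.hasDerivAt_negMulLog hD
      exact hn.comp (0 : ℝ) hl
  have hmax : IsLocalMax (fun t : ℝ => ∑ D, Real.negMulLog (p D + t * (q D - p D))) 0 := by
    have hev : ∀ᶠ t in nhds (0 : ℝ), ∀ D, 0 ≤ p D + t * (q D - p D) := by
      rw [Filter.eventually_all]
      intro D
      by_cases hD : p D = 0
      · simp [hD, supp_maxEnt hp hq D hD]
      · have hpos : 0 < p D := lt_of_le_of_ne (hp.1.1.1 D) (Ne.symm hD)
        have hc : ContinuousAt (fun t : ℝ => p D + t * (q D - p D)) 0 := by fun_prop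
        have := hc.eventually (lt_mem_nhds (a := 0) (by simpa using hpos))
        filter_upwards [this] with t ht using ht.le
    filter_upwards [hev] with t ht
    have := hp.2 _ (consistent_line hp.1 hq t ht)
    rw [entropy_eq, entropy_eq] at this
    simpa using this
  have h0 := hmax.hasDerivAt_eq_zero hd
  have h1 : ∑ D, (-Real.log (p D) - 1) * (q D - p D)
      = ∑ D, p D * Real.log (p D) - ∑ D, q D * Real.log (p D) - (∑ D, q D - ∑ D, p D) := by
    simp only [← Finset.sum_sub_distrib]
    exact Finset.sum_congr rfl fun D _ => by ring
  rw [h1, hq.1.2, hp.1.1.2] at h0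
  linarith

lemma KL_maxEnt {Ts : Finset (Tile n m)} {α : Tile n m → ℝ} {p q : Dataset n m → ℝ}
    (hp : IsMaxEnt Ts α p) (hq : Consistent Ts α q) :
    KL q p = entropy p - entropy q := by
  have h : KL q p = ∑ D, q D * Real.log (q D) - ∑ D, q D * Real.log (p D) := by
    rw [KL, ← Finset.sum_sub_distrib]
    refine Finset.sum_congr rfl fun D _ => ?_
    by_cases h1 : q D = 0
    · simp [h1]
    · have h2 : p D ≠ 0 := fun h => h1 (supp_maxEnt hp hq D h)
      rw [Real.log_div h1 h2]; ring
  rw [h, cross_maxEnt hp hq, entropy, entropy]; ring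

lemma Consistent.mono {Ts Us : Finset (Tile n m)} {α : Tile n m → ℝ} {p : Dataset n m → ℝ}
    (hp : Consistent Us α p) (h : Ts ⊆ Us) : Consistent Ts α p :=
  ⟨hp.1, fun T hT => hp.2 T (h hT)⟩

/-- A distribution whose entry marginals agree on each tile with a consistent one is consistent. -/
lemma freq_of_mg {T : Tile n m} {p q : Dataset n m → ℝ} {a : ℝ}
    (hp : freqP T p = a) (h : ∀ e ∈ area T, mg q e = mg p e) : freqP T q = a := by
  rw [← hp, freqP_eq_mg, freqP_eq_mg, Finset.sum_congr rfl h]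

/-- Gluing along `A`: tiles of `Xs` lie in `A ∪ area Bs`, tiles of `Ys` in `Aᶜ ∪ area Bs`. -/
lemma glue_consistent (Din : Dataset n m) (Xs Ys Bs : Finset (Tile n m))
    (hexB : ∀ T ∈ Bs, freqD T Din = 0 ∨ freqD T Din = 1) (A : Finset (Fin n × Fin m))
    (hX : ∀ e ∈ areaSet Xs, e ∈ A ∨ e ∈ areaSet Bs)
    (hY : ∀ e ∈ areaSet Ys, e ∉ A ∨ e ∈ areaSet Bs) {p r : Dataset n m → ℝ}
    (hp : Consistent (Xs ∪ Bs) (fun T => freqD T Din) p)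
    (hr : Consistent (Ys ∪ Bs) (fun T => freqD T Din) r) :
    Consistent (Xs ∪ Ys ∪ Bs) (fun T => freqD T Din) (glue A p r) := by
  have hBp : ∀ e ∈ areaSet Bs, mg p e = mg r e := fun e he => by
    rw [mg_exact Din Bs hexB (hp.mono Finset.subset_union_right) he,
      mg_exact Din Bs hexB (hr.mono Finset.subset_union_right) he]
  refine ⟨glue_dist A hp.1 hr.1, fun T hT => ?_⟩
  rw [Finset.mem_union, Finset.mem_union] at hT
  rcases hT with (hT | hT) | hT
  · refine freq_of_mg (hp.2 T (Finset.mem_union_left _ hT)) fun e he => ?_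
    rw [mg_glue A hp.1 hr.1]
    split_ifs with hA
    · rfl
    · exact (hBp e ((hX e (Finset.mem_biUnion.mpr ⟨T, hT, he⟩)).resolve_left hA)).symm
  · refine freq_of_mg (hr.2 T (Finset.mem_union_left _ hT)) fun e he => ?_
    rw [mg_glue A hp.1 hr.1]
    split_ifs with hA
    · exact hBp e ((hY e (Finset.mem_biUnion.mpr ⟨T, hT, he⟩)).resolve_left (not_not.mpr hA))
    · rfl
  · refine freq_of_mg (hp.2 T (Finset.mem_union_right _ hT)) fun e he => ?_
    rw [mg_glue A hp.1 hr.1]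
    split_ifs with hA
    · rfl
    · exact (hBp e (Finset.mem_biUnion.mpr ⟨T, hT, he⟩)).symm

/-- If all tiles in `Bs` are exact w.r.t. `Din` and
`area(Ts) ∩ area(Us) ⊆ area(Bs)`, then the distance computed from maximum entropy
distributions equals `1`. -/
theorem dist_eq_one_of_disjoint {n m : ℕ} (Din : Dataset n m) (Ts Us Bs : Finset (Tile n m))
    (hne : ∀ T ∈ Ts ∪ Us ∪ Bs, (area T).Nonempty)
    (hexB : ∀ T ∈ Bs, freqD T Din = 0 ∨ freqD T Din = 1)
    (harea : areaSet Ts ∩ areaSet Us ⊆ areaSet Bs)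
    (pM pTB pUB pB : Dataset n m → ℝ)
    (hM : IsMaxEnt (Ts ∪ Us ∪ Bs) (fun T => freqD T Din) pM)
    (hTB : IsMaxEnt (Ts ∪ Bs) (fun T => freqD T Din) pTB)
    (hUB : IsMaxEnt (Us ∪ Bs) (fun T => freqD T Din) pUB)
    (hB : IsMaxEnt Bs (fun T => freqD T Din) pB) :
    distKL pM pTB pUB pB = 1 := by
  have hMB : Consistent Bs (fun T => freqD T Din) pM :=
    hM.1.mono Finset.subset_union_right
  have hMT : Consistent (Ts ∪ Bs) (fun T => freqD T Din) pM :=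
    hM.1.mono (Finset.union_subset_union_left Finset.subset_union_left)
  have hMU : Consistent (Us ∪ Bs) (fun T => freqD T Din) pM :=
    hM.1.mono (Finset.union_subset_union_left Finset.subset_union_right)
  have hTBB : Consistent Bs (fun T => freqD T Din) pTB := hTB.1.mono Finset.subset_union_right
  have hUBB : Consistent Bs (fun T => freqD T Din) pUB := hUB.1.mono Finset.subset_union_right
  have hX : ∀ e ∈ areaSet Ts, e ∈ areaSet Ts ∨ e ∈ areaSet Bs := fun e he => Or.inl he
  have hY : ∀ e ∈ areaSet Us, e ∉ areaSet Ts ∨ e ∈ areaSet Bs := fun e he => by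
    by_cases h : e ∈ areaSet Ts
    · exact Or.inr (harea (Finset.mem_inter.mpr ⟨h, he⟩))
    · exact Or.inl h
  have hE1 : ∀ e ∈ areaSet (∅ : Finset (Tile n m)), e ∈ areaSet Ts ∨ e ∈ areaSet Bs := by
    simp [areaSet]
  have hE2 : ∀ e ∈ areaSet (∅ : Finset (Tile n m)), e ∉ areaSet Ts ∨ e ∈ areaSet Bs := by
    simp [areaSet]
  have c1 := hM.2 _ (glue_consistent Din Ts Us Bs hexB (areaSet Ts) hX hY hTB.1 hUB.1)
  have c2 := hB.2 _ (by
    simpa using glue_consistent Din ∅ ∅ Bs hexB (areaSet Ts) hE1 hE2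
      (p := pUB) (r := pTB) (by simpa using hUBB) (by simpa using hTBB))
  have c3 := hTB.2 _ (by
    simpa using glue_consistent Din Ts ∅ Bs hexB (areaSet Ts) hX hE2
      (p := pM) (r := pB) hMT (by simpa using hB.1))
  have c4 := hUB.2 _ (by
    simpa using glue_consistent Din ∅ Us Bs hexB (areaSet Ts) hE1 hY
      (p := pB) (r := pM) (by simpa using hB.1) hMU)
  have s1 := entropy_glue (areaSet Ts) hTB.1.1 hUB.1.1
  have s2 := entropy_glue (areaSet Ts) hM.1.1 hB.1.1
  unfold distKL
  split_ifs with h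
  · rfl
  · rw [div_eq_one_iff_eq h, KL_maxEnt hUB hMU, KL_maxEnt hTB hMT, KL_maxEnt hB hMB]
    linarith
end TileCompare
end

section
/- Let D_in be a fixed n×m binary dataset and let 𝒮, 𝒯, 𝒰, ℬ be finite collections of tiles, each tile with nonempty area and exact with respect to D_in. Then the distance computed from the corresponding product distributions satisfies the triangle inequality: d(𝒯,𝒰;ℬ) ≤ d(𝒯,𝒮;ℬ) + d(𝒮,𝒰;ℬ). -/
open Finset

namespace TileCompare

variable {n m : ℕ}

theorem mu_nonneg' (Din : Dataset n m) (Ts : Finset (Tile n m))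
    (e : Fin n × Fin m) (v : Bool) : 0 ≤ mu Din Ts e v := by
  unfold mu; split_ifs <;> norm_num

theorem prodDist_sum_pos (Din : Dataset n m) (Ts : Finset (Tile n m)) :
    0 < ∑ D : Dataset n m, prodDist Din Ts D := by
  apply Finset.sum_pos'
  · intro D _
    exact Finset.prod_nonneg fun e _ => mu_nonneg' _ _ _ _
  · refine ⟨Din, Finset.mem_univ _, Finset.prod_pos fun e _ => ?_⟩
    unfold mu; split_ifs <;> norm_num at *

/-- Off the zero set, the ratio of the product distributions is a power of two. -/
theorem KL_eq (Din : Dataset n m) (M A : Finset (Tile n m)) (h : areaSet A ⊆ areaSet M) :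
    KL (prodDist Din M) (prodDist Din A) =
      ((∑ D : Dataset n m, prodDist Din M D) * Real.log 2) *
        ((areaSet M \ areaSet A).card : ℝ) := by
  unfold KL
  rw [mul_assoc, Finset.sum_mul]
  refine Finset.sum_congr rfl fun D _ => ?_
  by_cases h0 : prodDist Din M D = 0
  · simp [h0]
  congr 1
  have hag : ∀ e ∈ areaSet M, Din e.1 e.2 = D e.1 e.2 := by
    intro e he
    by_contra hc
    apply h0
    unfold prodDist
    apply Finset.prod_eq_zero (Finset.mem_univ e)
    simp [mu, he, hc]
  have hr : prodDist Din M D / prodDist Din A D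
      = ∏ e : Fin n × Fin m, if e ∈ areaSet M \ areaSet A then (2 : ℝ) else 1 := by
    unfold prodDist
    rw [← Finset.prod_div_distrib]
    refine Finset.prod_congr rfl fun e _ => ?_
    unfold mu
    by_cases hM : e ∈ areaSet M
    · have := hag e hM
      by_cases hA : e ∈ areaSet A <;> simp [hM, hA, this]
    · have hA : e ∉ areaSet A := fun hh => hM (h hh)
      simp [hM, hA]
  rw [hr, Finset.prod_ite_mem, Finset.univ_inter, Finset.prod_const, Real.log_pow, mul_comm]

/-- Jaccard distance, with value one on a pair of empty sets. -/
noncomputable def jac {α : Type*} [DecidableEq α] (P Q : Finset α) : ℝ :=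
  if (P ∪ Q).card = 0 then 1 else (((P \ Q) ∪ (Q \ P)).card : ℝ) / ((P ∪ Q).card : ℝ)

theorem distE_eq (Din : Dataset n m) (Ts Us Bs : Finset (Tile n m)) :
    distE Din Ts Us Bs = jac (areaSet Ts \ areaSet Bs) (areaSet Us \ areaSet Bs) := by
  have hu : ∀ X Y : Finset (Tile n m), areaSet (X ∪ Y) = areaSet X ∪ areaSet Y := by
    intro X Y; unfold areaSet; exact Finset.union_biUnion
  unfold distE jac
  have hk : 0 < (∑ D : Dataset n m, prodDist Din (Ts ∪ Us ∪ Bs) D) * Real.log 2 :=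
    mul_pos (prodDist_sum_pos _ _) (Real.log_pos (by norm_num))
  rw [KL_eq Din (Ts ∪ Us ∪ Bs) Bs (by rw [hu]; exact Finset.subset_union_right),
    KL_eq Din (Ts ∪ Us ∪ Bs) (Us ∪ Bs) (by simp only [hu]; intro x; simp; tauto),
    KL_eq Din (Ts ∪ Us ∪ Bs) (Ts ∪ Bs) (by simp only [hu]; intro x; simp; tauto)]
  set k := (∑ D : Dataset n m, prodDist Din (Ts ∪ Us ∪ Bs) D) * Real.log 2
  simp only [hu]
  generalize areaSet Ts = T
  generalize areaSet Us = U
  generalize areaSet Bs = B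
  have e1 : (T ∪ U ∪ B) \ B = T \ B ∪ U \ B := by ext; simp; tauto
  have e2 : (T ∪ U ∪ B) \ (U ∪ B) = (T \ B) \ (U \ B) := by ext; simp; tauto
  have e3 : (T ∪ U ∪ B) \ (T ∪ B) = (U \ B) \ (T \ B) := by ext; simp; tauto
  rw [e1, e2, e3, Finset.card_union_of_disjoint
    (disjoint_sdiff_sdiff : Disjoint ((T \ B) \ (U \ B)) ((U \ B) \ (T \ B))), ← mul_add,
    mul_div_mul_left _ _ hk.ne']
  simp only [mul_eq_zero, hk.ne', false_or, Nat.cast_eq_zero, Nat.cast_add]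

theorem jac_nonneg {α : Type*} [DecidableEq α] (P Q : Finset α) : 0 ≤ jac P Q := by
  unfold jac; split_ifs <;> positivity

theorem sd_le {α : Type*} [DecidableEq α] (P Q : Finset α) :
    ((P \ Q) ∪ (Q \ P)).card ≤ (P ∪ Q).card :=
  Finset.card_le_card (by intro x; simp; tauto)

theorem jac_le_one {α : Type*} [DecidableEq α] (P Q : Finset α) : jac P Q ≤ 1 := by
  unfold jac; split_ifs
  · exact le_rfl
  · apply div_le_one_of_le₀ _ (by positivity)
    exact_mod_cast sd_le P Q

theorem le_jac {α : Type*} [DecidableEq α] (P Q : Finset α) (N : ℕ) (hN : (P ∪ Q).card ≤ N)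
    (h : (P ∪ Q).card ≠ 0) :
    (((P \ Q) ∪ (Q \ P)).card : ℝ) / N ≤ jac P Q := by
  unfold jac
  rw [if_neg h]
  have : 0 < (P ∪ Q).card := Nat.pos_of_ne_zero h
  gcongr

theorem jac_triangle {α : Type*} [DecidableEq α] (P S R : Finset α) :
    jac P R ≤ jac P S + jac S R := by
  by_cases h1 : (P ∪ S).card = 0
  · have : jac P S = 1 := by unfold jac; rw [if_pos h1]
    linarith [jac_le_one P R, jac_nonneg S R]
  by_cases h2 : (S ∪ R).card = 0
  · have : jac S R = 1 := by unfold jac; rw [if_pos h2]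
    linarith [jac_le_one P R, jac_nonneg P S]
  by_cases h3 : (P ∪ R).card = 0
  · have : P = ∅ ∧ R = ∅ := by simpa [Finset.union_eq_empty] using h3
    obtain ⟨rfl, rfl⟩ := this
    have hS : S ≠ ∅ := by simpa using h1
    simp [jac, hS]
  set N := (P ∪ S ∪ R).card with hN
  have a1 := le_jac P S N (Finset.card_le_card (by intro x; simp; tauto)) h1
  have a2 := le_jac S R N (Finset.card_le_card (by intro x; simp; tauto)) h2
  set x := (S \ (P ∪ R)).card with hx
  have hNx : N = (P ∪ R).card + x := by
    rw [hN, hx, ← Finset.card_union_of_disjoint Finset.disjoint_sdiff]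
    congr 1; ext; simp; tauto
  have key : ((P \ R) ∪ (R \ P)).card + x
      ≤ ((P \ S) ∪ (S \ P)).card + ((S \ R) ∪ (R \ S)).card := by
    rw [hx, ← Finset.card_union_of_disjoint]
    · refine (Finset.card_le_card ?_).trans (Finset.card_union_le _ _)
      intro y; simp; tauto
    · rw [Finset.disjoint_left]; intro y; simp; tauto
  have a3 := sd_le P R
  have h : jac P R ≤ ((((P \ R) ∪ (R \ P)).card : ℝ) + x) / N := by
    unfold jac
    rw [if_neg h3, hNx]
    have hp : (0 : ℝ) < (P ∪ R).card := by exact_mod_cast Nat.pos_of_ne_zero h3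
    have a3' : (((P \ R) ∪ (R \ P)).card : ℝ) ≤ (P ∪ R).card := by exact_mod_cast a3
    have hx0 : (0 : ℝ) ≤ x := by positivity
    push_cast
    rw [div_le_div_iff₀ hp (by positivity)]
    nlinarith [mul_le_mul_of_nonneg_right a3' hx0]
  have h' : ((((P \ R) ∪ (R \ P)).card : ℝ) + x) / N
      ≤ (((P \ S) ∪ (S \ P)).card : ℝ) / N + (((S \ R) ∪ (R \ S)).card : ℝ) / N := by
    rw [← add_div]
    refine div_le_div_of_nonneg_right ?_ (by positivity)
    exact_mod_cast key
  linarith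

/-- For exact tile collections the distance satisfies the
triangle inequality. -/
theorem dist_triangle {n m : ℕ} (Din : Dataset n m) (Ss Ts Us Bs : Finset (Tile n m))
    (hne : ∀ T ∈ Ss ∪ Ts ∪ Us ∪ Bs, (area T).Nonempty)
    (hex : ∀ T ∈ Ss ∪ Ts ∪ Us ∪ Bs, freqD T Din = 0 ∨ freqD T Din = 1) :
    distE Din Ts Us Bs ≤ distE Din Ts Ss Bs + distE Din Ss Us Bs := by
  simp only [distE_eq]
  exact jac_triangle _ _ _
end TileCompare
end

section
/- For finite sets A, B, C (subsets of some fixed finite universe) such that A ∪ B, A ∪ C, and B ∪ C are all nonempty, the following inequality holds: |A ∩ C|/|A ∪ C| + |B ∩ C|/|B ∪ C| − |A ∩ B|/|A ∪ B| ≤ 1. Equivalently, the Jaccard dissimilarity 1 − |X ∩ Y|/|X ∪ Y| satisfies the triangle inequality on such sets. -/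
open Finset

namespace TileCompare

variable {n m : ℕ}

/-- A fraction in `[0,1]` increases when the same amount is added to both parts. -/
theorem div_le_shift (x y u : ℝ) (hxy : x ≤ y) (hy : 0 < y) (hyu : y ≤ u) :
    x / y ≤ (x + (u - y)) / u := by
  rw [div_le_div_iff₀ hy (lt_of_lt_of_le hy hyu)]
  nlinarith [mul_nonneg (sub_nonneg.2 hxy) (sub_nonneg.2 hyu)]

/-- Triangle inequality for the Jaccard dissimilarity, in the form
`|A∩C|/|A∪C| + |B∩C|/|B∪C| − |A∩B|/|A∪B| ≤ 1` for finite sets with nonempty unions. -/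
theorem jaccard_triangle {α : Type*} [DecidableEq α] [Fintype α] (A B C : Finset α)
    (hAB : (A ∪ B).Nonempty) (hAC : (A ∪ C).Nonempty) (hBC : (B ∪ C).Nonempty) :
    ((A ∩ C).card : ℝ) / ((A ∪ C).card : ℝ)
      + ((B ∩ C).card : ℝ) / ((B ∪ C).card : ℝ)
      - ((A ∩ B).card : ℝ) / ((A ∪ B).card : ℝ) ≤ 1 := by
  have c1 := Finset.card_union_add_card_inter (A ∪ C) (B ∪ C)
  have e1 : (A ∪ C) ∩ (B ∪ C) = (A ∩ B) ∪ C := by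
    ext x; simp only [Finset.mem_inter, Finset.mem_union]; tauto
  have e2 : (A ∪ C) ∪ (B ∪ C) = A ∪ B ∪ C := by
    ext x; simp only [Finset.mem_union]; tauto
  rw [e1, e2] at c1
  have c2 := Finset.card_union_add_card_inter (A ∩ B) C
  have c3 := Finset.card_union_add_card_inter (A ∩ C) (B ∩ C)
  have e3 : (A ∩ C) ∩ (B ∩ C) = A ∩ B ∩ C := by
    ext x; simp only [Finset.mem_inter]; tauto
  rw [e3] at c3
  have c4 : ((A ∩ C) ∪ (B ∩ C)).card ≤ C.card :=
    Finset.card_le_card (Finset.union_subset Finset.inter_subset_right Finset.inter_subset_right)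
  have c5 : (A ∩ B ∩ C).card ≤ (A ∩ B).card := Finset.card_le_card Finset.inter_subset_left
  have key : (A ∪ B ∪ C).card + (A ∩ C).card + (B ∩ C).card
      ≤ (A ∪ C).card + (B ∪ C).card + (A ∩ B).card := by omega
  have keyR : ((A ∪ B ∪ C).card : ℝ) + (A ∩ C).card + (B ∩ C).card
      ≤ (A ∪ C).card + (B ∪ C).card + (A ∩ B).card := by exact_mod_cast key
  have pAB : (0 : ℝ) < (A ∪ B).card := by exact_mod_cast hAB.card_pos
  have pAC : (0 : ℝ) < (A ∪ C).card := by exact_mod_cast hAC.card_pos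
  have pBC : (0 : ℝ) < (B ∪ C).card := by exact_mod_cast hBC.card_pos
  have uAB : ((A ∪ B).card : ℝ) ≤ (A ∪ B ∪ C).card := by
    exact_mod_cast Finset.card_le_card Finset.subset_union_left
  have uAC : ((A ∪ C).card : ℝ) ≤ (A ∪ B ∪ C).card := by
    rw [← e2]; exact_mod_cast Finset.card_le_card Finset.subset_union_left
  have uBC : ((B ∪ C).card : ℝ) ≤ (A ∪ B ∪ C).card := by
    rw [← e2]; exact_mod_cast Finset.card_le_card Finset.subset_union_right
  have iAC : ((A ∩ C).card : ℝ) ≤ (A ∪ C).card := by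
    exact_mod_cast Finset.card_le_card Finset.inter_subset_union
  have iBC : ((B ∩ C).card : ℝ) ≤ (B ∪ C).card := by
    exact_mod_cast Finset.card_le_card Finset.inter_subset_union
  have pU := lt_of_lt_of_le pAB uAB
  have h1 := div_le_shift _ _ _ iAC pAC uAC
  have h2 := div_le_shift _ _ _ iBC pBC uBC
  have h3 : ((A ∩ B).card : ℝ) / (A ∪ B ∪ C).card ≤ ((A ∩ B).card : ℝ) / (A ∪ B).card :=
    div_le_div_of_nonneg_left (Nat.cast_nonneg _) pAB uAB
  refine (sub_le_sub (add_le_add h1 h2) h3).trans ?_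
  rw [← add_div, ← sub_div, div_le_one pU]
  linarith
end TileCompare
end

section
/- Let 𝒯, 𝒰, ℬ be finite tile sets (each tile with nonempty area) with target frequencies all computed from a single dataset D_in, and let U ∈ 𝒰. Let 𝓜 = 𝒯∪𝒰∪ℬ and let p_𝓜, p_{𝒯∪ℬ}, p_{(𝒯∪{U})∪ℬ}, p_{𝒰∪ℬ}, p_ℬ be maximum entropy distributions for the respective tile sets. Assume KL(p_𝓜‖p_X) = H(p_X) − H(p_𝓜) for X ∈ {𝒯∪ℬ, (𝒯∪{U})∪ℬ, 𝒰∪ℬ, ℬ}. Then d(𝒯∪{U}, 𝒰; ℬ) ≤ d(𝒯, 𝒰; ℬ). -/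
open Finset

namespace TileCompare

variable {n m : ℕ}

/-- Adding a tile `U ∈ Us` to `Ts` does not increase the distance to `Us`,
under the assumption that the KL divergences from the joint maximum entropy model equal
the corresponding entropy differences. -/
theorem dist_add_tile {n m : ℕ} (Din : Dataset n m) (Ts Us Bs : Finset (Tile n m))
    (U : Tile n m) (hU : U ∈ Us)
    (hne : ∀ T ∈ Ts ∪ Us ∪ Bs, (area T).Nonempty)
    (pM pTB pTUB pUB pB : Dataset n m → ℝ)
    (hM : IsMaxEnt (Ts ∪ Us ∪ Bs) (fun T => freqD T Din) pM)
    (hTB : IsMaxEnt (Ts ∪ Bs) (fun T => freqD T Din) pTB)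
    (hTUB : IsMaxEnt ((insert U Ts) ∪ Bs) (fun T => freqD T Din) pTUB)
    (hUB : IsMaxEnt (Us ∪ Bs) (fun T => freqD T Din) pUB)
    (hB : IsMaxEnt Bs (fun T => freqD T Din) pB)
    (hklTB : KL pM pTB = entropy pTB - entropy pM)
    (hklTUB : KL pM pTUB = entropy pTUB - entropy pM)
    (hklUB : KL pM pUB = entropy pUB - entropy pM)
    (hklB : KL pM pB = entropy pB - entropy pM) :
    distKL pM pTUB pUB pB ≤ distKL pM pTB pUB pB := by
  have h1 : entropy pTUB ≤ entropy pTB := by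
    refine hTB.2 _ ⟨hTUB.1.1, fun T hT => hTUB.1.2 T ?_⟩
    simp only [Finset.mem_union, Finset.mem_insert] at hT ⊢
    tauto
  have h2 : entropy pM ≤ entropy pB := by
    refine hB.2 _ ⟨hM.1.1, fun T hT => hM.1.2 T ?_⟩
    exact Finset.mem_union_right _ hT
  unfold distKL
  split_ifs with h
  · exact le_rfl
  · have h3 : 0 ≤ KL pM pB := by linarith
    exact div_le_div_of_nonneg_right (by linarith) h3
end TileCompare
end

section
/- Let 𝒜 and ℬ be finite tile sets (each tile with nonempty area) with ℬ ⊆ 𝒜 and target frequencies computed from a single dataset D_in, and let p_𝒜 and p_ℬ be maximum entropy distributions for 𝒜 and ℬ respectively. Assume p_ℬ has the exponential form: there exist λ₀ ∈ ℝ and weights (λ_T)_{T∈ℬ} with p_ℬ(D) = exp( λ₀ + ∑_{T∈ℬ} λ_T |area(T)| freq(T;D) ) whenever p_ℬ(D) > 0, and that p_𝒜(D) = 0 whenever p_ℬ(D) = 0. Then KL(p_𝒜 ‖ p_ℬ) = H(p_ℬ) − H(p_𝒜). -/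
open Finset

namespace TileCompare

variable {n m : ℕ}

/-- For maximum entropy distributions `pA`, `pB` of nested tile sets
`Bs ⊆ As`, with `pB` of exponential form and `pA` absolutely continuous w.r.t. `pB`,
the KL divergence equals the entropy difference: `KL(pA‖pB) = H(pB) − H(pA)`. -/
theorem kl_eq_entropy_diff {n m : ℕ} (Din : Dataset n m) (As Bs : Finset (Tile n m))
    (hne : ∀ T ∈ As, (area T).Nonempty)
    (hsub : Bs ⊆ As)
    (pA pB : Dataset n m → ℝ)
    (hA : IsMaxEnt As (fun T => freqD T Din) pA)
    (hB : IsMaxEnt Bs (fun T => freqD T Din) pB)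
    (lam0 : ℝ) (lam : Tile n m → ℝ)
    (hform : ∀ D : Dataset n m, 0 < pB D →
      pB D = Real.exp (lam0 + ∑ T ∈ Bs, lam T * ((area T).card : ℝ) * freqD T D))
    (habs : ∀ D : Dataset n m, pB D = 0 → pA D = 0) :
    KL pA pB = entropy pB - entropy pA := by
  have key : ∀ p : Dataset n m → ℝ, Consistent Bs (fun T => freqD T Din) p →
      (∀ D, pB D = 0 → p D = 0) →
      ∑ D, p D * Real.log (pB D) =
        lam0 + ∑ T ∈ Bs, lam T * ((area T).card : ℝ) * freqD T Din := by
    intro p hp h0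
    have h1 : ∀ D, p D * Real.log (pB D) =
        p D * lam0 + ∑ T ∈ Bs, lam T * ((area T).card : ℝ) * (p D * freqD T D) := by
      intro D
      rcases (hB.1.1.1 D).eq_or_lt with h | h
      · simp [h0 D h.symm]
      · rw [hform D h, Real.log_exp, mul_add, Finset.mul_sum]
        congr 1
        exact Finset.sum_congr rfl fun T _ => by ring
    rw [Finset.sum_congr rfl fun D _ => h1 D, Finset.sum_add_distrib, ← Finset.sum_mul,
      hp.1.2, one_mul, Finset.sum_comm]
    congr 1
    refine Finset.sum_congr rfl fun T hT => ?_
    rw [← Finset.mul_sum]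
    congr 1
    exact hp.2 T hT
  have kA := key pA ⟨hA.1.1, fun T hT => hA.1.2 T (hsub hT)⟩ habs
  have kB := key pB hB.1 fun _ h => h
  have hKL : KL pA pB = ∑ D, pA D * Real.log (pA D) - ∑ D, pA D * Real.log (pB D) := by
    unfold KL
    rw [← Finset.sum_sub_distrib]
    refine Finset.sum_congr rfl fun D _ => ?_
    by_cases h : pA D = 0
    · simp [h]
    · rw [Real.log_div h fun hb => h (habs D hb)]
      ring
  rw [hKL, kA, ← kB]
  unfold entropy
  ring
end TileCompare
end
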